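/- arXiv:2106.07046 — 2 statements merged into one kernel-verified Lean document; each statement's English description precedes it below -/
import Mathlib

section
/- Let γ ∈ [1/2, 1), let ε ∈ (0, 1/32], and let p₁, p₂ ∈ {γ, γ+ε(1−γ), γ+2ε(1−γ)} with p₁ > p₂. Then (1−γ)·p₁·γ/((1−γ·p₁)·(2−γ)) − (1−γ)·p₂·γ/((1−γ·p₂)·(2−γ)) = γ·(1−γ)·(p₁−p₂)/((2−γ)·(1−γ·p₁)·(1−γ·p₂)), and this quantity is at least ε/8. -/
/-- Per-state suboptimality gap in the lower-bound construction. -/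
theorem suboptimality_gap
    (γ ε p₁ p₂ : ℝ) (hγ0 : 1 / 2 ≤ γ) (hγ1 : γ < 1)
    (hε0 : 0 < ε) (hε1 : ε ≤ 1 / 32)
    (hp₁ : p₁ ∈ ({γ, γ + ε * (1 - γ), γ + 2 * ε * (1 - γ)} : Set ℝ))
    (hp₂ : p₂ ∈ ({γ, γ + ε * (1 - γ), γ + 2 * ε * (1 - γ)} : Set ℝ))
    (hlt : p₂ < p₁) :
    (1 - γ) * p₁ * γ / ((1 - γ * p₁) * (2 - γ)) - (1 - γ) * p₂ * γ / ((1 - γ * p₂) * (2 - γ))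
        = γ * (1 - γ) * (p₁ - p₂) / ((2 - γ) * (1 - γ * p₁) * (1 - γ * p₂))
      ∧ ε / 8 ≤ γ * (1 - γ) * (p₁ - p₂) / ((2 - γ) * (1 - γ * p₁) * (1 - γ * p₂)) := by
  have ht : 0 < ε * (1 - γ) := mul_pos hε0 (sub_pos.2 hγ1)
  have htle : ε * (1 - γ) ≤ 1 / 32 * (1 - γ) :=
    mul_le_mul_of_nonneg_right hε1 (sub_pos.2 hγ1).le
  have bounds : ∀ p ∈ ({γ, γ + ε * (1 - γ), γ + 2 * ε * (1 - γ)} : Set ℝ), γ ≤ p ∧ p < 1 := by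
    rintro p (rfl | rfl | rfl) <;> constructor <;> linarith
  have factor : ∀ p, γ ≤ p → p < 1 → 0 < 1 - γ * p ∧ 1 - γ * p ≤ (1 - γ) * (1 + γ) := by
    intro p hγp hp
    constructor <;> nlinarith
  have hgap : ε * (1 - γ) ≤ p₁ - p₂ := by
    rcases hp₁ with rfl | rfl | rfl <;> rcases hp₂ with h | h | h <;> subst h <;> linarith
  obtain ⟨hpos₁, hle₁⟩ := factor p₁ (bounds p₁ hp₁).1 (bounds p₁ hp₁).2
  obtain ⟨hpos₂, hle₂⟩ := factor p₂ (bounds p₂ hp₂).1 (bounds p₂ hp₂).2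
  have hγ : 0 < 1 - γ := sub_pos.2 hγ1
  have hγ2 : 0 < 2 - γ := by linarith
  constructor
  · rw [div_sub_div _ _ (by positivity) (by positivity),
      div_eq_div_iff (by positivity) (by positivity)]
    ring
  · rw [le_div_iff₀ (by positivity)]
    have hcubic : (2 - γ) * (1 + γ) ^ 2 ≤ 8 * γ := by
      nlinarith [pow_pos (show 0 < γ by linarith) 3]
    calc ε / 8 * ((2 - γ) * (1 - γ * p₁) * (1 - γ * p₂))
        ≤ ε / 8 * ((2 - γ) * ((1 - γ) * (1 + γ)) * ((1 - γ) * (1 + γ))) := by gcongr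
      _ = ε / 8 * (1 - γ) ^ 2 * ((2 - γ) * (1 + γ) ^ 2) := by ring
      _ ≤ ε / 8 * (1 - γ) ^ 2 * (8 * γ) := by gcongr
      _ = γ * (1 - γ) * (ε * (1 - γ)) := by ring
      _ ≤ γ * (1 - γ) * (p₁ - p₂) := by gcongr
end

section
/- Let γ ∈ [1/2, 1) and ε ∈ (0, 1/32], and set a = γ·(γ + 2ε(1−γ)) and b = γ². Then 0 < b ≤ a < 1 and the Kullback–Leibler divergence between the Bernoulli distributions with parameters a and b satisfies a·log(a/b) + (1−a)·log((1−a)/(1−b)) ≤ 4·ε²·(1−γ). -/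
/-- The Kullback–Leibler divergence between two Bernoulli distributions is at most their
chi-square divergence. -/
theorem bernoulli_kl_le_chiSq {a b : ℝ} (ha0 : 0 < a) (ha1 : a < 1) (hb0 : 0 < b) (hb1 : b < 1) :
    a * Real.log (a / b) + (1 - a) * Real.log ((1 - a) / (1 - b))
      ≤ (a - b) ^ 2 / (b * (1 - b)) := by
  have ha' : 0 < 1 - a := sub_pos.mpr ha1
  have hb' : 0 < 1 - b := sub_pos.mpr hb1
  have h₁ := mul_le_mul_of_nonneg_left (Real.log_le_sub_one_of_pos (div_pos ha0 hb0)) ha0.le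
  have h₂ := mul_le_mul_of_nonneg_left (Real.log_le_sub_one_of_pos (div_pos ha' hb')) ha'.le
  refine (add_le_add h₁ h₂).trans_eq ?_
  field_simp
  ring

/-- KL divergence bound between the two Bernoulli arms in the lower-bound construction. -/
theorem kl_divergence_bound
    (γ ε : ℝ) (hγ0 : 1 / 2 ≤ γ) (hγ1 : γ < 1)
    (hε0 : 0 < ε) (hε1 : ε ≤ 1 / 32)
    (a b : ℝ) (ha : a = γ * (γ + 2 * ε * (1 - γ))) (hb : b = γ ^ 2) :
    (0 < b ∧ b ≤ a ∧ a < 1)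
      ∧ a * Real.log (a / b) + (1 - a) * Real.log ((1 - a) / (1 - b))
          ≤ 4 * ε ^ 2 * (1 - γ) := by
  have hγ : 0 < γ := by linarith
  have hγ' : 0 < 1 - γ := sub_pos.mpr hγ1
  have hd : a - b = 2 * ε * γ * (1 - γ) := by rw [ha, hb]; ring
  have hb0 : 0 < b := by rw [hb]; positivity
  have hba : b ≤ a := by
    have : 0 < 2 * ε * γ * (1 - γ) := by positivity
    linarith
  have ha1 : a < 1 := by
    have h : γ + 2 * ε * (1 - γ) < 1 := by nlinarith
    rw [ha]
    exact mul_lt_one_of_nonneg_of_lt_one_left hγ.le hγ1 h.le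
  have hb1 : b < 1 := hba.trans_lt ha1
  refine ⟨⟨hb0, hba, ha1⟩, (bernoulli_kl_le_chiSq (hb0.trans_le hba) ha1 hb0 hb1).trans ?_⟩
  rw [div_le_iff₀ (mul_pos hb0 (sub_pos.mpr hb1)), hd, hb]
  have h : 0 ≤ 4 * ε ^ 2 * (1 - γ) ^ 2 * γ ^ 3 := by positivity
  linarith
end
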